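/- arXiv:2508.21808 — 2 statements merged into one kernel-verified Lean document; each statement's English description precedes it below -/
import Mathlib

section
/- Let A be a unital star ring and let U, V ∈ Mₙ(A), where the star of a matrix is its conjugate transpose (star U)(i,j) = star(U(j,i)). Suppose U is unitary in Mₙ(A) (i.e. U·(star U) = 1 = (star U)·U) and every entry of U commutes with every entry of V: U(i,j)·V(k,l) = V(k,l)·U(i,j) for all i,j,k,l. Then every starred entry of U commutes with every entry of V: star(U(i,j))·V(k,l) = V(k,l)·star(U(i,j)) for all i,j,k,l. -/
/-- If `U` is a unitary matrix over a unital star ring `A` (star being the conjugate transpose)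
whose entries commute with all the entries of `V`, then the starred entries of `U` also commute
with all the entries of `V`. -/
theorem star_entries_commute_of_unitary {A : Type*} [Ring A] [StarRing A] {n : ℕ}
    (U V : Matrix (Fin n) (Fin n) A)
    (hU : U * star U = 1 ∧ star U * U = 1)
    (hcomm : ∀ i j k l, U i j * V k l = V k l * U i j) :
    ∀ i j k l, star (U i j) * V k l = V k l * star (U i j) := by
  intro i j k l
  have h1 : U * Matrix.diagonal (fun _ => V k l) = Matrix.diagonal (fun _ => V k l) * U := by
    ext a b
    rw [Matrix.mul_diagonal, Matrix.diagonal_mul]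
    exact hcomm a b k l
  have h2 : star U * Matrix.diagonal (fun _ => V k l)
      = Matrix.diagonal (fun _ => V k l) * star U := by
    calc star U * Matrix.diagonal (fun _ => V k l)
        = star U * (Matrix.diagonal (fun _ => V k l) * (U * star U)) := by
          rw [hU.1, mul_one]
      _ = star U * (U * Matrix.diagonal (fun _ => V k l)) * star U := by
          rw [h1]; simp only [mul_assoc]
      _ = Matrix.diagonal (fun _ => V k l) * star U := by
          rw [← mul_assoc (star U) U, hU.2, one_mul]
  have h3 := congrFun (congrFun h2 j) i
  rw [Matrix.mul_diagonal, Matrix.diagonal_mul, Matrix.star_apply] at h3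
  exact h3
end

section
/- Let A be a unital C*-algebra, n ≥ 1, and let U ∈ Mₙ(A) be unitary (U·(star U) = 1 = (star U)·U, star being the conjugate transpose). With c(a,a') = (1/n)·e^{−2πi·a·a'/n}, define M(a) = (∑_{a'} c(a,a') • U(a',a')) · star(∑_{b'} c(a,b') • U(b',b')) for a ∈ Fin n, using the diagonal entries of U. Then each M(a) is positive (0 ≤ M(a)) and ∑_{a} M(a) ≤ 1 in the canonical order of A. -/
theorem aux_orth {n : ℕ} (hn : 1 ≤ n) (c : Fin n → Fin n → ℂ)
    (hc : ∀ a a' : Fin n, c a a' = (1 / (n : ℂ)) *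
      Complex.exp (-(2 * Real.pi * Complex.I * (a.val : ℂ) * (a'.val : ℂ)) / n))
    (i j : Fin n) : ∑ a, c a i * star (c a j) = if i = j then (1 / (n : ℂ)) else 0 := by
  have hn0 : (n : ℂ) ≠ 0 := by exact_mod_cast (by omega : n ≠ 0)
  have hζ := Complex.isPrimitiveRoot_exp n (by omega)
  set ζ := Complex.exp (2 * Real.pi * Complex.I / n) with hζd
  have hζ0 : ζ ≠ 0 := Complex.exp_ne_zero _
  have h1 : ∀ a : Fin n, c a i * star (c a j)
      = (1 / (n : ℂ)) ^ 2 * (ζ ^ j.val / ζ ^ i.val) ^ a.val := by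
    intro a
    have e : (ζ ^ j.val / ζ ^ i.val) ^ a.val =
        Complex.exp (-(2 * Real.pi * Complex.I * (a.val : ℂ) * (i.val : ℂ)) / n) *
        Complex.exp ((2 * Real.pi * Complex.I * (a.val : ℂ) * (j.val : ℂ)) / n) := by
      rw [hζd, ← Complex.exp_nat_mul, ← Complex.exp_nat_mul, ← Complex.exp_sub,
        ← Complex.exp_nat_mul, ← Complex.exp_add]
      congr 1
      ring
    have e2 : star (c a j) = (1 / (n : ℂ)) *
        Complex.exp ((2 * Real.pi * Complex.I * (a.val : ℂ) * (j.val : ℂ)) / n) := by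
      rw [hc, Complex.star_def, map_mul, ← Complex.exp_conj]
      have h2 : (starRingEnd ℂ) 2 = 2 := Complex.conj_ofNat 2
      simp [h2]
    rw [e, e2, hc]
    ring
  simp_rw [h1]
  rw [← Finset.mul_sum, Fin.sum_univ_eq_sum_range (fun a => (ζ ^ j.val / ζ ^ i.val) ^ a)]
  split_ifs with h
  · subst h
    rw [div_self (pow_ne_zero _ hζ0)]
    simp
    field_simp
  · have hw : ζ ^ j.val / ζ ^ i.val ≠ 1 := by
      intro hh
      rw [div_eq_one_iff_eq (pow_ne_zero _ hζ0)] at hh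
      exact h (Fin.ext (hζ.pow_inj j.2 i.2 hh).symm)
    have hwn : (ζ ^ j.val / ζ ^ i.val) ^ n = 1 := by
      rw [div_pow, pow_right_comm, pow_right_comm ζ i.val, hζ.pow_eq_one]
      simp
    rw [geom_sum_eq hw, hwn]
    simp

/-- The sub-POVM elements `M a` built from diagonal entries of a unitary matrix over a unital
C*-algebra via the Fourier coefficients `c a a' = (1/n)·e^{−2πi·a·a'/n}` are positive and sum to
at most `1`. -/
theorem sub_povm_from_unitary {A : Type*} [CStarAlgebra A] [PartialOrder A] [StarOrderedRing A]
    {n : ℕ} (hn : 1 ≤ n) (U : Matrix (Fin n) (Fin n) A)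
    (hU : U * star U = 1 ∧ star U * U = 1)
    (c : Fin n → Fin n → ℂ)
    (hc : ∀ a a' : Fin n, c a a' = (1 / (n : ℂ)) *
      Complex.exp (-(2 * Real.pi * Complex.I * (a.val : ℂ) * (a'.val : ℂ)) / n))
    (M : Fin n → A)
    (hM : ∀ a, M a = (∑ a', c a a' • U a' a') * star (∑ b', c a b' • U b' b')) :
    (∀ a, 0 ≤ M a) ∧ ∑ a, M a ≤ 1 := by
  refine ⟨fun a => by rw [hM]; exact mul_star_self_nonneg _, ?_⟩
  have hsum : ∑ a, M a = ∑ i, (1 / (n : ℝ)) • (U i i * star (U i i)) := by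
    simp_rw [hM, star_sum, star_smul, Finset.sum_mul_sum, smul_mul_smul_comm]
    rw [Finset.sum_comm]
    refine Finset.sum_congr rfl fun i _ => ?_
    rw [Finset.sum_comm]
    simp_rw [← Finset.sum_smul, aux_orth hn c hc, ite_smul, zero_smul]
    rw [Finset.sum_ite_eq Finset.univ i]
    simp only [Finset.mem_univ, if_true]
    rw [← Complex.coe_smul]
    simp
  have hle : ∀ i, U i i * star (U i i) ≤ 1 := by
    intro i
    have h : ∑ k, U i k * star (U i k) = 1 := by
      have := congrFun (congrFun hU.1 i) i
      simpa [Matrix.mul_apply, Matrix.star_apply] using this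
    rw [← h]
    exact Finset.single_le_sum (f := fun k => U i k * star (U i k))
      (fun k _ => mul_star_self_nonneg _) (Finset.mem_univ i)
  have hn0 : (n : ℝ) ≠ 0 := by exact_mod_cast (by omega : n ≠ 0)
  rw [hsum]
  calc _ ≤ ∑ i : Fin n, (1 / (n : ℝ)) • (1 : A) :=
        Finset.sum_le_sum fun i _ => smul_le_smul_of_nonneg_left (hle i) (by positivity)
    _ = 1 := by
      rw [← Finset.sum_smul]
      simp [hn0]
end
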